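/- The 3-sphere (10⁰₍₃₂,₃₃₎) with facet list F0={0,2,4,5,9}, F1={0,2,4,6,8}, F2={1,3,6,7,9}, F3={1,3,4,6,8}, F4={0,2,5,7,8}, F5={1,3,5,7,8}, F6={0,1,4,6,9}, F7={2,3,5,7,9}, F8={1,2,4,7,8}, F9={1,2,4,7,9}, F10={0,3,5,6,8,9} (subsets of Fin 10) has no polytopal realization; i.e., there is no injective v : Fin 10 → ℝ⁴ such that every v j is an extreme point of P = convexHull ℝ (Set.range v) and the set of facets (3-dimensional proper faces) of P equals { convexHull ℝ (v '' F_i) : 0 ≤ i ≤ 10 }. -/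

import Mathlib

open Module

/-- The facet list of the 3-sphere `(10⁰₍₃₂,₃₃₎)`. -/
def facets : Fin 11 → Set (Fin 10) :=
  ![{0,2,4,5,9}, {0,2,4,6,8}, {1,3,6,7,9}, {1,3,4,6,8}, {0,2,5,7,8},
    {1,3,5,7,8}, {0,1,4,6,9}, {2,3,5,7,9}, {1,2,4,7,8}, {1,2,4,7,9},
    {0,3,5,6,8,9}]

/-- Slack minors of size six vanish in dimension four. -/
theorem slack_det (c : Fin 11 → ℝ) (l : Fin 11 → StrongDual ℝ (EuclideanSpace ℝ (Fin 4)))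
    (v : Fin 10 → EuclideanSpace ℝ (Fin 4)) (r : Fin 6 → Fin 11) (s : Fin 6 → Fin 10) :
    (Matrix.of fun i j => c (r i) - l (r i) (v (s j))).det = 0 := by
  have h : ¬ LinearIndependent ℝ (fun j : Fin 6 => ((1 : ℝ), v (s j))) := by
    intro h
    have := h.fintype_card_le_finrank
    simp at this
  rw [Fintype.not_linearIndependent_iff] at h
  obtain ⟨g, hg, k, hk⟩ := h
  have h1 : ∑ j, g j = 0 := by simpa [Prod.fst_sum] using congrArg Prod.fst hg
  have h2 : ∑ j, g j • v (s j) = 0 := by simpa [Prod.snd_sum] using congrArg Prod.snd hg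
  refine Matrix.exists_mulVec_eq_zero_iff.mp ⟨g, fun h0 => hk (by simp [h0]), ?_⟩
  ext i
  have h3 := congrArg (l (r i)) h2
  simp only [map_sum, map_smul, smul_eq_mul, map_zero] at h3
  simp only [Matrix.mulVec, dotProduct, Matrix.of_apply, Pi.zero_apply, sub_mul,
    Finset.sum_sub_distrib, ← Finset.mul_sum, h1]
  simp only [mul_comm _ (g _), h3]
  simp

set_option maxHeartbeats 4000000 in
/-- Explicit minor. -/
theorem minor0 (a01 a07 a08 a20 a22 a24 a28 a30 a32 a37 a62 a67 a68 a80 a90 a98 : ℝ) :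
    (!![0, a01, 0, 0, a07, a08; a20, 0, a22, a24, 0, a28; a30, 0, a32, 0, a37, 0; 0, 0, a62, 0, a67, a68; a80, 0, 0, 0, 0, 0; a90, 0, 0, 0, 0, a98] : Matrix (Fin 6) (Fin 6) ℝ).det =
    0 - a01 * a24 * a32 * a67 * a80 * a98 + a01 * a24 * a37 * a62 * a80 * a98 := by
  simp [Matrix.det_succ_row_zero, Fin.sum_univ_succ, Fin.succAbove]
  ring

set_option maxHeartbeats 4000000 in
/-- Explicit minor. -/
theorem minor1 (a30 a32 a37 a41 a43 a50 a52 a62 a63 a67 a68 a70 a71 a78 a80 a83 : ℝ) :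
    (!![a30, 0, a32, 0, a37, 0; 0, a41, 0, a43, 0, 0; a50, 0, a52, 0, 0, 0; 0, 0, a62, a63, a67, a68; a70, a71, 0, 0, 0, a78; a80, 0, 0, a83, 0, 0] : Matrix (Fin 6) (Fin 6) ℝ).det =
    0 + a30 * a41 * a52 * a67 * a78 * a83 - a32 * a41 * a50 * a67 * a78 * a83 + a37 * a41 * a50 * a62 * a78 * a83 + a37 * a41 * a52 * a63 * a78 * a80 + a37 * a41 * a52 * a68 * a70 * a83 + a37 * a43 * a52 * a68 * a71 * a80 := by
  simp [Matrix.det_succ_row_zero, Fin.sum_univ_succ, Fin.succAbove]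
  ring

/-- The 3-sphere `(10⁰₍₃₂,₃₃₎)` has no polytopal realization. -/
theorem sphere_10_32_33_11_a_not_polytopal :
    ¬ ∃ v : Fin 10 → EuclideanSpace ℝ (Fin 4),
      Function.Injective v ∧
      (∀ j, v j ∈ convexHull ℝ (Set.range v) ∧
        v j ∉ convexHull ℝ (convexHull ℝ (Set.range v) \ {v j})) ∧
      {F : Set (EuclideanSpace ℝ (Fin 4)) |
          F ≠ ∅ ∧ F ≠ convexHull ℝ (Set.range v) ∧
          IsExposed ℝ (convexHull ℝ (Set.range v)) F ∧
          finrank ℝ (vectorSpan ℝ F) = 3} =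
        Set.range (fun i : Fin 11 => convexHull ℝ (v '' facets i)) := by
  rintro ⟨v, hinj, hext, hF⟩
  have key : ∀ i : Fin 11, ∃ (l : StrongDual ℝ (EuclideanSpace ℝ (Fin 4))) (c : ℝ),
      ∀ j, (j ∈ facets i → c - l (v j) = 0) ∧ (j ∉ facets i → 0 < c - l (v j)) := by
    intro i
    have hi : convexHull ℝ (v '' facets i) ∈ Set.range (fun i : Fin 11 => convexHull ℝ (v '' facets i)) :=
      ⟨i, rfl⟩
    rw [← hF] at hi
    obtain ⟨hne, -, hexp, -⟩ := hi
    have hne' := Set.nonempty_iff_ne_empty.mpr hne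
    obtain ⟨l, hl⟩ := hexp hne'
    obtain ⟨x0, hx0⟩ := hne'
    have hx1 := hl ▸ hx0
    refine ⟨l, l x0, fun j => ⟨fun hj => ?_, fun hj => ?_⟩⟩
    · have : v j ∈ convexHull ℝ (v '' facets i) := subset_convexHull _ _ ⟨j, hj, rfl⟩
      rw [hl] at this
      have a := this.2 x0 hx1.1
      have b := hx1.2 (v j) this.1
      linarith
    · have hn : v j ∉ convexHull ℝ (v '' facets i) := by
        intro h
        apply (hext j).2
        refine convexHull_mono ?_ h
        rintro _ ⟨k, hk, rfl⟩
        exact ⟨(hext k).1, fun he => hj (hinj he ▸ hk)⟩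
      by_contra hcon
      apply hn
      rw [hl]
      exact ⟨(hext j).1, fun y hy => (hx1.2 y hy).trans (by linarith)⟩
  choose l c hlc using key
  obtain ⟨S, hS⟩ : ∃ S : Fin 11 → Fin 10 → ℝ, ∀ i j, S i j = c i - l i (v j) := ⟨_, fun _ _ => rfl⟩
  have hdet : ∀ (r : Fin 6 → Fin 11) (s : Fin 6 → Fin 10),
      (Matrix.of fun i j => S (r i) (s j)).det = 0 := by
    intro r s
    simpa only [hS] using slack_det c l v r s
  have hz : ∀ i j, j ∈ facets i → S i j = 0 := fun i j h => by rw [hS]; exact (hlc i j).1 h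
  have hp : ∀ i j, j ∉ facets i → 0 < S i j := fun i j h => by rw [hS]; exact (hlc i j).2 h
  clear hS hlc hF hext hinj
  have D0 := hdet ![0,2,3,6,8,9] ![0,1,2,4,7,8]
  have M0 : (Matrix.of fun i j => S ((![0,2,3,6,8,9] : Fin 6 → Fin 11) i) ((![0,1,2,4,7,8] : Fin 6 → Fin 10) j)) =
      !![0, S 0 1, 0, 0, S 0 7, S 0 8; S 2 0, 0, S 2 2, S 2 4, 0, S 2 8; S 3 0, 0, S 3 2, 0, S 3 7, 0; 0, 0, S 6 2, 0, S 6 7, S 6 8; S 8 0, 0, 0, 0, 0, 0; S 9 0, 0, 0, 0, 0, S 9 8] := by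
    ext i j
    fin_cases i <;> fin_cases j <;> first | rfl | exact hz _ _ (by simp [facets])
  rw [M0, minor0] at D0
  have D1 := hdet ![3,4,5,6,7,8] ![0,1,2,3,7,8]
  have M1 : (Matrix.of fun i j => S ((![3,4,5,6,7,8] : Fin 6 → Fin 11) i) ((![0,1,2,3,7,8] : Fin 6 → Fin 10) j)) =
      !![S 3 0, 0, S 3 2, 0, S 3 7, 0; 0, S 4 1, 0, S 4 3, 0, 0; S 5 0, 0, S 5 2, 0, 0, 0; 0, 0, S 6 2, S 6 3, S 6 7, S 6 8; S 7 0, S 7 1, 0, 0, 0, S 7 8; S 8 0, 0, 0, S 8 3, 0, 0] := by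
    ext i j
    fin_cases i <;> fin_cases j <;> first | rfl | exact hz _ _ (by simp [facets])
  rw [M1, minor1] at D1
  have p01 := hp 0 1 (by simp [facets])
  have p24 := hp 2 4 (by simp [facets])
  have p30 := hp 3 0 (by simp [facets])
  have p37 := hp 3 7 (by simp [facets])
  have p41 := hp 4 1 (by simp [facets])
  have p43 := hp 4 3 (by simp [facets])
  have p52 := hp 5 2 (by simp [facets])
  have p63 := hp 6 3 (by simp [facets])
  have p67 := hp 6 7 (by simp [facets])
  have p68 := hp 6 8 (by simp [facets])
  have p70 := hp 7 0 (by simp [facets])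
  have p71 := hp 7 1 (by simp [facets])
  have p78 := hp 7 8 (by simp [facets])
  have p80 := hp 8 0 (by simp [facets])
  have p83 := hp 8 3 (by simp [facets])
  have p98 := hp 9 8 (by simp [facets])
  have q : 0 < S 0 1 * S 2 4 * S 8 0 * S 9 8 := by positivity
  have B : S 3 2 * S 6 7 = S 3 7 * S 6 2 := by
    apply mul_left_cancel₀ q.ne'
    linarith
  have t0 : 0 < S 3 7 * S 4 1 * S 5 2 * S 6 8 * S 7 0 * S 8 3 := by positivity
  have t1 : 0 < S 3 7 * S 4 3 * S 5 2 * S 6 8 * S 7 1 * S 8 0 := by positivity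
  have t2 : 0 < S 3 7 * S 4 1 * S 5 2 * S 6 3 * S 7 8 * S 8 0 := by positivity
  have t3 : 0 < S 3 0 * S 4 1 * S 5 2 * S 6 7 * S 7 8 * S 8 3 := by positivity
  have B2 := congrArg (fun x => S 4 1 * S 5 0 * S 7 8 * S 8 3 * x) B
  linarith
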